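/- Monotonicity of observational entropy under coarser measurements: let n be a positive integer, ρ and τ density matrices on ℂ^n, ι and κ finite types, and M : ι → Matrix n n ℂ a POVM (each M i positive semidefinite, Σ_i M i = 1). Let Λ : κ → ι → ℝ be a stochastic matrix (Λ j i ≥ 0, Σ_j Λ j i = 1), and define the coarser POVM N j = Σ_i Λ j i • M i. Let p i = Re Tr(M i * ρ), q i = Re Tr(M i * τ), p' j = Re Tr(N j * ρ), q' j = Re Tr(N j * τ), and assume that q i = 0 implies p i = 0 for every i. Then D(p'‖q') ≤ D(p‖q); equivalently, the observational entropy satisfies S_N^τ(ρ) ≥ S_M^τ(ρ). -/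

import Mathlib

open Real Finset Matrix ComplexOrder

open scoped MatrixOrder in
/-- The trace of a product of two positive semidefinite matrices has nonnegative real part. -/
theorem Matrix.PosSemidef.re_trace_mul_nonneg {n : Type*} [Fintype n] [DecidableEq n]
    {A B : Matrix n n ℂ} (hA : A.PosSemidef) (hB : B.PosSemidef) : 0 ≤ (A * B).trace.re := by
  obtain ⟨C, rfl⟩ := CStarAlgebra.nonneg_iff_eq_star_mul_self.mp hA.nonneg
  rw [Matrix.mul_assoc, Matrix.trace_mul_comm]
  exact (Complex.le_def.mp (hB.mul_mul_conjTranspose_same C).trace_nonneg).1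

/-- The log sum inequality. -/
theorem sum_mul_log_sum_div_sum_le {ι : Type*} (s : Finset ι) (a b : ι → ℝ)
    (ha : ∀ i ∈ s, 0 ≤ a i) (hb : ∀ i ∈ s, 0 ≤ b i) (hab : ∀ i ∈ s, b i = 0 → a i = 0) :
    (∑ i ∈ s, a i) * Real.log ((∑ i ∈ s, a i) / ∑ i ∈ s, b i) ≤
      ∑ i ∈ s, a i * Real.log (a i / b i) := by
  set A := ∑ i ∈ s, a i with hA
  set B := ∑ i ∈ s, b i with hB
  rcases (Finset.sum_nonneg ha).eq_or_lt with hA0 | hApos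
  · have h0 := (Finset.sum_eq_zero_iff_of_nonneg ha).mp hA0.symm
    rw [← hA] at hA0
    rw [← hA0, zero_mul, Finset.sum_eq_zero fun i hi => by rw [h0 i hi, zero_mul]]
  rw [← hA] at hApos
  have hBpos : 0 < B := by
    refine (Finset.sum_nonneg hb).lt_of_ne fun h => hApos.ne' ?_
    have h0 := (Finset.sum_eq_zero_iff_of_nonneg hb).mp h.symm
    exact Finset.sum_eq_zero fun i hi => hab i hi (h0 i hi)
  have key : ∀ i ∈ s, a i * Real.log (A / B) + (a i - b i * (A / B)) ≤
      a i * Real.log (a i / b i) := by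
    intro i hi
    rcases (ha i hi).eq_or_lt with h | hai
    · have := mul_nonneg (hb i hi) (div_pos hApos hBpos).le
      simp only [← h, zero_mul]
      linarith
    have hbi : 0 < b i := (hb i hi).lt_of_ne fun h => hai.ne' (hab i hi h.symm)
    have hlog := Real.log_le_sub_one_of_pos (div_pos (div_pos hApos hBpos) (div_pos hai hbi))
    rw [Real.log_div (div_pos hApos hBpos).ne' (div_pos hai hbi).ne'] at hlog
    have hmul := mul_le_mul_of_nonneg_left hlog hai.le
    have heq : a i * (A / B / (a i / b i) - 1) = b i * (A / B) - a i := by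
      field_simp
    linarith
  calc A * Real.log (A / B)
      = ∑ i ∈ s, (a i * Real.log (A / B) + (a i - b i * (A / B))) := by
        rw [Finset.sum_add_distrib, Finset.sum_sub_distrib, ← Finset.sum_mul, ← Finset.sum_mul,
          ← hA, ← hB, mul_div_cancel₀ _ hBpos.ne', sub_self, add_zero]
    _ ≤ _ := Finset.sum_le_sum key

/-- Data processing inequality for the relative entropy of finite nonnegative vectors under a
stochastic matrix. -/
theorem sum_mul_log_div_stochastic_le {ι κ : Type*} [Fintype ι] [Fintype κ]
    (Λ : κ → ι → ℝ) (hΛ0 : ∀ j i, 0 ≤ Λ j i) (hΛ1 : ∀ i, ∑ j, Λ j i = 1)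
    (p q : ι → ℝ) (hp : ∀ i, 0 ≤ p i) (hq : ∀ i, 0 ≤ q i) (habs : ∀ i, q i = 0 → p i = 0) :
    ∑ j, (∑ i, Λ j i * p i) * Real.log ((∑ i, Λ j i * p i) / ∑ i, Λ j i * q i) ≤
      ∑ i, p i * Real.log (p i / q i) := by
  calc _ ≤ ∑ j, ∑ i, Λ j i * p i * Real.log (Λ j i * p i / (Λ j i * q i)) := by
        refine Finset.sum_le_sum fun j _ => sum_mul_log_sum_div_sum_le _ _ _
          (fun i _ => mul_nonneg (hΛ0 j i) (hp i)) (fun i _ => mul_nonneg (hΛ0 j i) (hq i))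
          fun i _ h => ?_
        rcases mul_eq_zero.mp h with h | h
        · rw [h, zero_mul]
        · rw [habs i h, mul_zero]
    _ = ∑ j, ∑ i, Λ j i * (p i * Real.log (p i / q i)) := by
        refine Finset.sum_congr rfl fun j _ => Finset.sum_congr rfl fun i _ => ?_
        rcases eq_or_ne (Λ j i) 0 with h | h
        · simp [h]
        · rw [mul_div_mul_left _ _ h, mul_assoc]
    _ = _ := by
        rw [Finset.sum_comm]
        simp_rw [← Finset.sum_mul, hΛ1, one_mul]

/-- Monotonicity of observational entropy under coarser measurements:
if the POVM `N` is obtained from the POVM `M` by classical stochastic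
post-processing `Λ`, then the measured relative entropy can only decrease,
`D(p'‖q') ≤ D(p‖q)`; equivalently `S_N^τ(ρ) ≥ S_M^τ(ρ)`. -/
theorem observational_entropy_monotone_coarse_graining
    (n : ℕ) (hn : 0 < n) {ι κ : Type*} [Fintype ι] [Fintype κ]
    (ρ τ : Matrix (Fin n) (Fin n) ℂ)
    (hρ : ρ.PosSemidef) (hρtr : ρ.trace = 1)
    (hτ : τ.PosSemidef) (hτtr : τ.trace = 1)
    (M : ι → Matrix (Fin n) (Fin n) ℂ)
    (hMpos : ∀ i, (M i).PosSemidef) (hMsum : ∑ i, M i = 1)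
    (Λ : κ → ι → ℝ) (hΛ0 : ∀ j i, 0 ≤ Λ j i) (hΛ1 : ∀ i, ∑ j, Λ j i = 1)
    (N : κ → Matrix (Fin n) (Fin n) ℂ)
    (hN : ∀ j, N j = ∑ i, Λ j i • M i)
    (p q : ι → ℝ) (p' q' : κ → ℝ)
    (hp : ∀ i, p i = ((M i * ρ).trace).re)
    (hq : ∀ i, q i = ((M i * τ).trace).re)
    (hp' : ∀ j, p' j = ((N j * ρ).trace).re)
    (hq' : ∀ j, q' j = ((N j * τ).trace).re)
    (habs : ∀ i, q i = 0 → p i = 0) :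
    ∑ j, p' j * Real.log (p' j / q' j) ≤ ∑ i, p i * Real.log (p i / q i) := by
  have post : ∀ σ : Matrix (Fin n) (Fin n) ℂ, ∀ j,
      (N j * σ).trace.re = ∑ i, Λ j i * (M i * σ).trace.re := fun σ j => by
    simp [hN, Matrix.sum_mul, Matrix.trace_sum]
  have hp'' : ∀ j, p' j = ∑ i, Λ j i * p i := fun j => by simp_rw [hp', hp, post]
  have hq'' : ∀ j, q' j = ∑ i, Λ j i * q i := fun j => by simp_rw [hq', hq, post]
  simp_rw [hp'', hq'']
  exact sum_mul_log_div_stochastic_le Λ hΛ0 hΛ1 p q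
    (fun i => hp i ▸ (hMpos i).re_trace_mul_nonneg hρ)
    (fun i => hq i ▸ (hMpos i).re_trace_mul_nonneg hτ) habs
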